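/- Let T > 0 and δ ≥ 1, and define f : [0,1] → ℝ by f(z) = 2(√(1+z) − 1)/z for z ∈ (0,1] and f(0) = 1. Then for every z ∈ [0,1]: |cos((T/(2δ))·f(z/δ)) − cos(T/(2δ)) − (T/(8δ²))·sin(T/(2δ))·z| ≤ (T/(8δ³))·(1 + T/(8δ))·z², and |sin((T/(2δ))·f(z/δ)) − sin(T/(2δ)) + (T/(8δ²))·cos(T/(2δ))·z| ≤ (T/(8δ³))·(1 + T/(8δ))·z². (These are the second-order Taylor bounds, with T = pπ/q, used to approximate the solution of the linearised Smith equation at rational times by trigonometric polylogarithms.) -/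

import Mathlib

theorem self_sub_sin_le_sq_div_two {x : ℝ} (hx : 0 ≤ x) : x - Real.sin x ≤ x ^ 2 / 2 := by
  have hderiv : ∀ y : ℝ, HasDerivAt (fun y => y ^ 2 / 2 - y + Real.sin y)
      (y - 1 + Real.cos y) y := by
    intro y
    have h := (((hasDerivAt_pow 2 y).div_const 2).sub (hasDerivAt_id y)).add (Real.hasDerivAt_sin y)
    have hval : y - 1 + Real.cos y = ((2 : ℕ) : ℝ) * y ^ (2 - 1) / 2 - 1 + Real.cos y := by
      norm_num
    rw [hval]
    exact h
  have hmono : MonotoneOn (fun y : ℝ => y ^ 2 / 2 - y + Real.sin y) (Set.Ici 0) := by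
    refine monotoneOn_of_deriv_nonneg (convex_Ici 0) (by fun_prop)
      (fun y _ => (hderiv y).differentiableAt.differentiableWithinAt) fun y hy => ?_
    rw [interior_Ici] at hy
    have hy0 : 0 < y := hy
    rw [(hderiv y).deriv]
    rcases le_total y 2 with h2 | h2
    · nlinarith [Real.one_sub_sq_div_two_le_cos (x := y)]
    · linarith [Real.neg_one_le_cos y]
  have h := hmono (Set.mem_Ici.2 le_rfl) (Set.mem_Ici.2 hx) hx
  simp only [Real.sin_zero] at h
  linarith

theorem abs_sin_sub_self_le_sq_div_two (x : ℝ) : |Real.sin x - x| ≤ x ^ 2 / 2 := by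
  rcases le_total 0 x with hx | hx
  · rw [abs_le]
    constructor <;> nlinarith [self_sub_sin_le_sq_div_two hx, Real.sin_le hx]
  · have hx' : 0 ≤ -x := by linarith
    have h₁ := self_sub_sin_le_sq_div_two hx'
    have h₂ := Real.sin_le hx'
    rw [Real.sin_neg] at h₁ h₂
    rw [abs_le]
    constructor <;> nlinarith

theorem abs_cos_sub_one_le_sq_div_two (x : ℝ) : |Real.cos x - 1| ≤ x ^ 2 / 2 := by
  rw [abs_le]
  constructor <;> nlinarith [Real.one_sub_sq_div_two_le_cos (x := x), Real.cos_le_one x]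

theorem abs_mul_le_of_abs_le_one {c u B : ℝ} (hc : |c| ≤ 1) (hu : |u| ≤ B) : |c * u| ≤ B := by
  rw [abs_mul]
  exact (mul_le_of_le_one_left (abs_nonneg u) hc).trans hu

theorem abs_cos_add_sub_le (a h e : ℝ) :
    |Real.cos (a + h) - Real.cos a - e * Real.sin a| ≤ h ^ 2 + |h + e| := by
  have h₁ := abs_mul_le_of_abs_le_one (Real.abs_cos_le_one a) (abs_cos_sub_one_le_sq_div_two h)
  have h₂ := abs_mul_le_of_abs_le_one (Real.abs_sin_le_one a) (abs_sin_sub_self_le_sq_div_two h)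
  have h₃ := abs_mul_le_of_abs_le_one (Real.abs_sin_le_one a) (le_refl |h + e|)
  rw [Real.cos_add]
  rw [abs_le] at h₁ h₂ h₃ ⊢
  constructor <;> linarith

theorem abs_sin_add_sub_le (a h e : ℝ) :
    |Real.sin (a + h) - Real.sin a + e * Real.cos a| ≤ h ^ 2 + |h + e| := by
  have h₁ := abs_mul_le_of_abs_le_one (Real.abs_sin_le_one a) (abs_cos_sub_one_le_sq_div_two h)
  have h₂ := abs_mul_le_of_abs_le_one (Real.abs_cos_le_one a) (abs_sin_sub_self_le_sq_div_two h)
  have h₃ := abs_mul_le_of_abs_le_one (Real.abs_cos_le_one a) (le_refl |h + e|)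
  rw [Real.sin_add]
  rw [abs_le] at h₁ h₂ h₃ ⊢
  constructor <;> linarith

theorem two_mul_sqrt_one_add_sub_one_div_bounds {w : ℝ} (hw : 0 < w) :
    -(w / 4) ≤ 2 * (Real.sqrt (1 + w) - 1) / w - 1 ∧
      2 * (Real.sqrt (1 + w) - 1) / w - 1 ≤ 0 ∧
      2 * (Real.sqrt (1 + w) - 1) / w - 1 + w / 4 ≤ w ^ 2 / 8 := by
  have hsq : Real.sqrt (1 + w) ^ 2 = 1 + w := Real.sq_sqrt (by linarith)
  have hs0 : 0 ≤ Real.sqrt (1 + w) := Real.sqrt_nonneg _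
  generalize Real.sqrt (1 + w) = s at hsq hs0 ⊢
  have hs1 : 1 < s := by nlinarith
  obtain rfl : w = s ^ 2 - 1 := by linarith
  have hval : 2 * (s - 1) / (s ^ 2 - 1) = 2 / (1 + s) := by
    rw [div_eq_div_iff hw.ne' (by linarith)]
    ring
  have hp : 0 < 1 + s := by linarith
  have hm : 0 ≤ s - 1 := by linarith
  rw [hval]
  refine ⟨?_, ?_, ?_⟩
  · rw [← sub_nonneg]
    have : 2 / (1 + s) - 1 - -((s ^ 2 - 1) / 4) = (s - 1) ^ 2 * (s + 3) / (4 * (1 + s)) := by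
      field_simp
      ring
    rw [this]
    positivity
  · rw [sub_nonpos, div_le_one hp]
    linarith
  · rw [← sub_nonneg]
    have : (s ^ 2 - 1) ^ 2 / 8 - (2 / (1 + s) - 1 + (s ^ 2 - 1) / 4) =
        (s - 1) ^ 2 * ((1 + s) ^ 3 - 2 * (s + 3)) / (8 * (1 + s)) := by
      field_simp
      ring
    rw [this]
    have : 0 ≤ (1 + s) ^ 3 - 2 * (s + 3) := by
      have : (1 + s) ^ 3 - 2 * (s + 3) = (s - 1) ^ 3 + 6 * (s - 1) ^ 2 + 10 * (s - 1) := by ring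
      rw [this]
      positivity
    positivity


/-- Second-order Taylor bounds (with `T = pπ/q`) used to approximate the solution of the
linearised Smith equation at rational times by trigonometric polylogarithms: for `T > 0`,
`δ ≥ 1`, and `f(z) = 2(√(1+z) − 1)/z` on `(0,1]` with `f(0) = 1`, for every `z ∈ [0,1]`,
`|cos((T/(2δ))f(z/δ)) − cos(T/(2δ)) − (T/(8δ²))sin(T/(2δ))z| ≤ (T/(8δ³))(1 + T/(8δ))z²` and
`|sin((T/(2δ))f(z/δ)) − sin(T/(2δ)) + (T/(8δ²))cos(T/(2δ))z| ≤ (T/(8δ³))(1 + T/(8δ))z²`. -/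
theorem smith_taylor_bounds (T δ : ℝ) (hT : 0 < T) (hδ : 1 ≤ δ)
    (f : ℝ → ℝ) (hf0 : f 0 = 1)
    (hf : ∀ z ∈ Set.Ioc (0 : ℝ) 1, f z = 2 * (Real.sqrt (1 + z) - 1) / z) :
    ∀ z ∈ Set.Icc (0 : ℝ) 1,
      |Real.cos (T / (2 * δ) * f (z / δ)) - Real.cos (T / (2 * δ)) -
          T / (8 * δ ^ 2) * Real.sin (T / (2 * δ)) * z| ≤
        T / (8 * δ ^ 3) * (1 + T / (8 * δ)) * z ^ 2 ∧
      |Real.sin (T / (2 * δ) * f (z / δ)) - Real.sin (T / (2 * δ)) +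
          T / (8 * δ ^ 2) * Real.cos (T / (2 * δ)) * z| ≤
        T / (8 * δ ^ 3) * (1 + T / (8 * δ)) * z ^ 2 := by
  intro z hz
  have hδ0 : 0 < δ := by linarith
  set w := z / δ with hw
  set a := T / (2 * δ) with ha
  have ha0 : 0 < a := by positivity
  have hw0 : 0 ≤ w := div_nonneg hz.1 hδ0.le
  have hw1 : w ≤ 1 := (div_le_one hδ0).2 (hz.2.trans hδ)
  have hbounds : -(w / 4) ≤ f w - 1 ∧ f w - 1 ≤ 0 ∧ f w - 1 + w / 4 ≤ w ^ 2 / 8 := by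
    rcases hw0.eq_or_lt with h | h
    · rw [← h, hf0]
      norm_num
    · rw [hf w ⟨h, hw1⟩]
      exact two_mul_sqrt_one_add_sub_one_div_bounds h
  obtain ⟨h₁, h₂, h₃⟩ := hbounds
  have harg : a * f w = a + a * (f w - 1) := by ring
  have hlin : T / (8 * δ ^ 2) * z = a * w / 4 := by
    rw [ha, hw]
    field_simp
    ring
  have hrhs : T / (8 * δ ^ 3) * (1 + T / (8 * δ)) * z ^ 2 = a / 4 * (1 + a / 4) * w ^ 2 := by
    rw [ha, hw]
    field_simp
    ring
  have hsq : (f w - 1) ^ 2 ≤ (w / 4) ^ 2 := by nlinarith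
  have herr : (a * (f w - 1)) ^ 2 + |a * (f w - 1) + a * w / 4| ≤
      a / 4 * (1 + a / 4) * w ^ 2 := by
    have habs : |a * (f w - 1) + a * w / 4| = a * (f w - 1 + w / 4) := by
      rw [← abs_of_nonneg (mul_nonneg ha0.le (by linarith : 0 ≤ f w - 1 + w / 4))]
      congr 1
      ring
    rw [habs]
    nlinarith [mul_le_mul_of_nonneg_left hsq (sq_nonneg a),
      mul_le_mul_of_nonneg_left h₃ ha0.le, mul_nonneg ha0.le (sq_nonneg w)]
  rw [hrhs, mul_right_comm _ (Real.sin a), mul_right_comm _ (Real.cos a), hlin, harg]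
  exact ⟨(abs_cos_add_sub_le _ _ _).trans herr, (abs_sin_add_sub_le _ _ _).trans herr⟩
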